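/- Lemma 4.2(ii): there exists a constant K > 0, depending only on the dimension d and on E ∈ ℝ, such that for every finite cube Λ ⊂ ℤ^d containing two fixed nearest-neighbour sites i₁, i₂, every λ > 0 and every 0 < δ ≤ 1/2, the matrix C_{++} = λ(1 − δ² 𝟙_{12}) − i(E + Δ) on ℂ^Λ is invertible and |Tr C_{++}^{−1}| ≥ |Λ| λ / (K (λ+1)²). -/

import Mathlib

open MeasureTheory Matrix

noncomputable section

/-- ℓ¹ distance on ℤ^d. -/
def dist1 {d : ℕ} (x y : Fin d → ℤ) : ℤ := ∑ i, |x i - y i|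

/-- The cube [-L, L]^d in ℤ^d, centered at the origin. -/
def cube (d L : ℕ) : Finset (Fin d → ℤ) :=
  Finset.Icc (fun _ => -(L : ℤ)) (fun _ => (L : ℤ))

/-- Entries of the discrete Laplacian associated to a finite volume Λ. -/
def lapE {d : ℕ} (Λ : Finset (Fin d → ℤ)) (j k : Fin d → ℤ) : ℂ :=
  (if dist1 j k = 1 then 1 else 0) -
    (if j = k then ((Λ.filter (fun k' => dist1 j k' = 1)).card : ℂ) else 0)

/-- The toymodel matrix `C_{++} = λ(1 - δ²𝟙_{12}) - i(E+Δ)` on `ℂ^Λ`, where `𝟙_{12}`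
is the diagonal projection onto the sites `i₁, i₂`. -/
def Cpp {d : ℕ} (Λ : Finset (Fin d → ℤ)) (i₁ i₂ : Fin d → ℤ) (E lam δ : ℝ) :
    Matrix Λ Λ ℂ := fun j k =>
  (lam : ℂ) * ((if j = k then 1 else 0) -
      (δ : ℂ) ^ 2 * (if j = k ∧ ((j : Fin d → ℤ) = i₁ ∨ (j : Fin d → ℤ) = i₂) then 1 else 0)) -
    Complex.I * ((if j = k then (E : ℂ) else 0) + lapE Λ (j : Fin d → ℤ) (k : Fin d → ℤ))

open scoped ComplexOrder in
/-- A complex matrix whose Hermitian part is a positive real diagonal matrix is invertible. -/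
theorem isUnit_det_of_add_conjTranspose_eq_diagonal {n : Type*} [Fintype n] [DecidableEq n]
    (A : Matrix n n ℂ) (w : n → ℝ) (hw : ∀ j, 0 < w j)
    (hA : A + Aᴴ = Matrix.diagonal (fun j => ((2 * w j : ℝ) : ℂ))) : IsUnit A.det := by
  rw [isUnit_iff_ne_zero]
  intro h0
  obtain ⟨v, hv, hAv⟩ := Matrix.exists_mulVec_eq_zero_iff.mpr h0
  have hpd : (Matrix.diagonal (fun j => ((2 * w j : ℝ) : ℂ))).PosDef := by
    refine Matrix.PosDef.diagonal fun j => ?_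
    have := hw j
    exact_mod_cast (by linarith : (0 : ℝ) < 2 * w j)
  have hpos := hpd.dotProduct_mulVec_pos hv
  rw [← hA, Matrix.add_mulVec, hAv, zero_add, Matrix.dotProduct_mulVec,
    ← Matrix.star_mulVec, hAv] at hpos
  simp at hpos

/-- If the Hermitian part of `A` is diagonal with entries at least `c > 0`, then `c` times the
squared Frobenius norm of `A⁻¹` is at most `‖tr A⁻¹‖`. -/
theorem mul_sum_sq_inv_le_norm_trace_inv {n : Type*} [Fintype n] [DecidableEq n]
    (A : Matrix n n ℂ) (w : n → ℝ) (c : ℝ) (hc : 0 < c) (hw : ∀ j, c ≤ w j)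
    (hA : A + Aᴴ = Matrix.diagonal (fun j => ((2 * w j : ℝ) : ℂ))) :
    c * ∑ j, ∑ k, ‖A⁻¹ j k‖ ^ 2 ≤ ‖A⁻¹.trace‖ := by
  have hu := isUnit_det_of_add_conjTranspose_eq_diagonal A w (fun j => hc.trans_le (hw j)) hA
  have hu' : IsUnit Aᴴ.det := by
    rw [Matrix.det_conjTranspose]
    exact hu.star
  have hG : A⁻¹ + A⁻¹ᴴ =
      A⁻¹ * Matrix.diagonal (fun j => ((2 * w j : ℝ) : ℂ)) * A⁻¹ᴴ := by
    rw [← hA, Matrix.mul_add, Matrix.nonsing_inv_mul _ hu, Matrix.add_mul, Matrix.one_mul,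
      Matrix.mul_assoc, Matrix.conjTranspose_nonsing_inv, Matrix.mul_nonsing_inv _ hu',
      Matrix.mul_one, add_comm]
  have htr := congrArg (fun M : Matrix n n ℂ => M.trace.re) hG
  have hl : (A⁻¹ + A⁻¹ᴴ).trace.re = 2 * A⁻¹.trace.re := by
    rw [Matrix.trace_add, Matrix.trace_conjTranspose]
    simp [two_mul]
  have hr : (A⁻¹ * Matrix.diagonal (fun j => ((2 * w j : ℝ) : ℂ)) * A⁻¹ᴴ).trace.re =
      ∑ j, ∑ k, 2 * w k * ‖A⁻¹ j k‖ ^ 2 := by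
    simp only [Matrix.trace, Matrix.diag_apply, Matrix.mul_apply (M := _ * _),
      Matrix.mul_diagonal, Complex.re_sum, Matrix.conjTranspose_apply]
    refine Finset.sum_congr rfl fun j _ => Finset.sum_congr rfl fun k _ => ?_
    rw [mul_right_comm, Complex.star_def, Complex.mul_conj, Complex.normSq_eq_norm_sq,
      ← Complex.ofReal_mul, Complex.ofReal_re]
    ring
  simp only [hl, hr] at htr
  have hle : c * ∑ j, ∑ k, ‖A⁻¹ j k‖ ^ 2 ≤ A⁻¹.trace.re := by
    have h2 : 2 * (c * ∑ j, ∑ k, ‖A⁻¹ j k‖ ^ 2) ≤ ∑ j, ∑ k, 2 * w k * ‖A⁻¹ j k‖ ^ 2 := by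
      rw [← mul_assoc, Finset.mul_sum]
      refine Finset.sum_le_sum fun j _ => ?_
      rw [Finset.mul_sum]
      refine Finset.sum_le_sum fun k _ => ?_
      have := hw k
      gcongr
    linarith
  exact hle.trans (Complex.re_le_norm _)

/-- Cauchy–Schwarz for the Frobenius norms of an invertible matrix and its inverse. -/
theorem card_sq_le_sum_sq_inv_mul_sum_sq {n : Type*} [Fintype n] [DecidableEq n]
    (A : Matrix n n ℂ) (hu : IsUnit A.det) :
    (Fintype.card n : ℝ) ^ 2 ≤ (∑ j, ∑ k, ‖A⁻¹ j k‖ ^ 2) * ∑ j, ∑ k, ‖A j k‖ ^ 2 := by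
  have h1 : (Fintype.card n : ℝ) ≤ ∑ p : n × n, ‖A⁻¹ p.1 p.2‖ * ‖A p.2 p.1‖ := by
    have ht : (A⁻¹ * A).trace = (Fintype.card n : ℂ) := by
      rw [Matrix.nonsing_inv_mul _ hu, Matrix.trace_one]
    calc (Fintype.card n : ℝ) = ‖(A⁻¹ * A).trace‖ := by rw [ht, Complex.norm_natCast]
      _ = ‖∑ p : n × n, A⁻¹ p.1 p.2 * A p.2 p.1‖ := by
        rw [Fintype.sum_prod_type]
        simp only [Matrix.trace, Matrix.diag_apply, Matrix.mul_apply]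
      _ ≤ _ := (norm_sum_le _ _).trans (by simp only [norm_mul]; exact le_rfl)
  have h2 := Finset.sum_mul_sq_le_sq_mul_sq (Finset.univ : Finset (n × n))
    (fun p => ‖A⁻¹ p.1 p.2‖) (fun p => ‖A p.2 p.1‖)
  rw [Fintype.sum_prod_type (fun p : n × n => ‖A⁻¹ p.1 p.2‖ ^ 2),
    Fintype.sum_prod_type_right (fun p : n × n => ‖A p.2 p.1‖ ^ 2)] at h2
  exact (pow_le_pow_left₀ (Nat.cast_nonneg _) h1 2).trans h2

/-- Lower bound for the trace of the inverse when the Hermitian part is diagonal and bounded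
below by `c`, and the squared Frobenius norm is at most `R` per row. -/
theorem mul_card_div_le_norm_trace_inv {n : Type*} [Fintype n] [DecidableEq n]
    (A : Matrix n n ℂ) (w : n → ℝ) (c R : ℝ) (hc : 0 < c) (hR : 0 < R) (hw : ∀ j, c ≤ w j)
    (hA : A + Aᴴ = Matrix.diagonal (fun j => ((2 * w j : ℝ) : ℂ)))
    (hrow : ∀ j, ∑ k, ‖A j k‖ ^ 2 ≤ R) :
    c * Fintype.card n / R ≤ ‖A⁻¹.trace‖ := by
  have hu := isUnit_det_of_add_conjTranspose_eq_diagonal A w (fun j => hc.trans_le (hw j)) hA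
  refine le_trans ?_ (mul_sum_sq_inv_le_norm_trace_inv A w c hc hw hA)
  have hcs := card_sq_le_sum_sq_inv_mul_sum_sq A hu
  set S := ∑ j, ∑ k, ‖A⁻¹ j k‖ ^ 2 with hS
  have hS0 : 0 ≤ S := by positivity
  have hF : ∑ j, ∑ k, ‖A j k‖ ^ 2 ≤ Fintype.card n * R := by
    simpa using Finset.sum_le_sum fun j (_ : j ∈ Finset.univ) => hrow j
  rw [mul_div_assoc]
  refine mul_le_mul_of_nonneg_left ?_ hc.le
  rw [div_le_iff₀ hR]
  rcases (Nat.cast_nonneg (α := ℝ) (Fintype.card n)).eq_or_lt with h0 | hpos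
  · rw [← h0]
    positivity
  · have := hcs.trans (mul_le_mul_of_nonneg_left hF hS0)
    refine le_of_mul_le_mul_left ?_ hpos
    linarith

theorem dist1_comm {d : ℕ} (x y : Fin d → ℤ) : dist1 x y = dist1 y x := by
  simp only [dist1, abs_sub_comm]

theorem dist1_self {d : ℕ} (x : Fin d → ℤ) : dist1 x x = 0 := by
  simp [dist1]

/-- A site of `ℤ^d` has at most `3 ^ d` nearest neighbours in any finite volume. -/
theorem card_filter_dist1_eq_one_le {d : ℕ} (Λ : Finset (Fin d → ℤ)) (j : Fin d → ℤ) :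
    (Λ.filter (fun k => dist1 j k = 1)).card ≤ 3 ^ d := by
  have hsub : Λ.filter (fun k => dist1 j k = 1) ⊆
      Finset.Icc (fun i => j i - 1) (fun i => j i + 1) := by
    intro k hk
    have hk1 := (Finset.mem_filter.mp hk).2
    have hi : ∀ i, |j i - k i| ≤ 1 := fun i => by
      rw [← hk1]
      exact Finset.single_le_sum (f := fun i => |j i - k i|) (fun _ _ => abs_nonneg _)
        (Finset.mem_univ i)
    rw [Finset.mem_Icc]
    constructor <;> intro i <;> have := abs_le.mp (hi i) <;> dsimp only <;> linarith
  refine (Finset.card_le_card hsub).trans_eq ?_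
  rw [Pi.card_Icc]
  have : ∀ i, (Finset.Icc (j i - 1) (j i + 1)).card = 3 := fun i => by
    rw [Int.card_Icc]
    omega
  simp [this]

theorem lapE_comm {d : ℕ} (Λ : Finset (Fin d → ℤ)) (j k : Fin d → ℤ) :
    lapE Λ j k = lapE Λ k j := by
  rcases eq_or_ne j k with rfl | h
  · rfl
  · simp [lapE, dist1_comm j k, h, h.symm]

theorem conj_lapE {d : ℕ} (Λ : Finset (Fin d → ℤ)) (j k : Fin d → ℤ) :
    (starRingEnd ℂ) (lapE Λ j k) = lapE Λ j k := by
  unfold lapE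
  split_ifs <;> simp

/-- The Hermitian part of `Cpp` is the diagonal matrix `λ(1 - δ²𝟙_{12})`. -/
theorem Cpp_add_conjTranspose {d : ℕ} (Λ : Finset (Fin d → ℤ)) (i₁ i₂ : Fin d → ℤ)
    (E lam δ : ℝ) :
    Cpp Λ i₁ i₂ E lam δ + (Cpp Λ i₁ i₂ E lam δ)ᴴ =
      Matrix.diagonal (fun j : Λ => ((2 * (lam * (1 - δ ^ 2 *
        (if (j : Fin d → ℤ) = i₁ ∨ (j : Fin d → ℤ) = i₂ then 1 else 0))) : ℝ) : ℂ)) := by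
  ext j k
  simp only [Matrix.add_apply, Matrix.conjTranspose_apply, Cpp]
  rcases eq_or_ne j k with rfl | h
  · by_cases h12 : (j : Fin d → ℤ) = i₁ ∨ (j : Fin d → ℤ) = i₂ <;>
      simp [h12, conj_lapE] <;> ring
  · simp [h, h.symm, conj_lapE, lapE_comm Λ k j]

/-- Row bound for `Cpp`. -/
theorem sum_norm_sq_Cpp_le {d : ℕ} (Λ : Finset (Fin d → ℤ)) (i₁ i₂ : Fin d → ℤ)
    (E lam δ : ℝ) (hlam : 0 < lam) (hδ : δ ^ 2 ≤ 1) (j : Λ) :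
    ∑ k, ‖Cpp Λ i₁ i₂ E lam δ j k‖ ^ 2 ≤ (lam + |E| + 3 ^ d) ^ 2 + 3 ^ d := by
  have hentry : ∀ k : Λ, ‖Cpp Λ i₁ i₂ E lam δ j k‖ ^ 2 ≤
      (if j = k then (lam + |E| + 3 ^ d) ^ 2 else 0) +
        (if dist1 (j : Fin d → ℤ) (k : Fin d → ℤ) = 1 then 1 else 0) := by
    intro k
    rcases eq_or_ne j k with rfl | h
    · simp only [if_true, dist1_self, zero_ne_one, if_false, add_zero]
      refine pow_le_pow_left₀ (norm_nonneg _) ?_ 2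
      set m := (Λ.filter (fun k' => dist1 (j : Fin d → ℤ) k' = 1)).card with hm
      have hmB : (m : ℝ) ≤ 3 ^ d := by
        exact_mod_cast card_filter_dist1_eq_one_le Λ (j : Fin d → ℤ)
      set e : ℝ := if (j : Fin d → ℤ) = i₁ ∨ (j : Fin d → ℤ) = i₂ then 1 else 0 with he
      have he01 : 0 ≤ e ∧ e ≤ 1 := by
        rw [he]
        split_ifs <;> norm_num
      have hval : Cpp Λ i₁ i₂ E lam δ j j =
          ((lam * (1 - δ ^ 2 * e) : ℝ) : ℂ) - Complex.I * ((E - m : ℝ) : ℂ) := by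
        by_cases h12 : (j : Fin d → ℤ) = i₁ ∨ (j : Fin d → ℤ) = i₂ <;>
          simp [Cpp, lapE, dist1_self, he, h12, ← hm, sub_eq_add_neg]
      have hd1 : |lam * (1 - δ ^ 2 * e)| ≤ lam := by
        have h1 : δ ^ 2 * e ≤ 1 := mul_le_one₀ hδ he01.1 he01.2
        have h2 : 0 ≤ δ ^ 2 * e := mul_nonneg (sq_nonneg _) he01.1
        rw [abs_of_nonneg (mul_nonneg hlam.le (by linarith))]
        nlinarith
      have hd2 : |E - m| ≤ |E| + 3 ^ d := by
        refine (abs_sub _ _).trans ?_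
        rw [abs_of_nonneg (Nat.cast_nonneg (α := ℝ) m)]
        linarith
      rw [hval]
      refine (norm_sub_le _ _).trans ?_
      rw [norm_mul, Complex.norm_I, one_mul, Complex.norm_real, Complex.norm_real,
        Real.norm_eq_abs, Real.norm_eq_abs]
      linarith
    · have h' : (j : Fin d → ℤ) ≠ k := fun hjk => h (Subtype.ext hjk)
      by_cases h1 : dist1 (j : Fin d → ℤ) (k : Fin d → ℤ) = 1 <;>
        simp [Cpp, lapE, h, h', h1]
  refine (Finset.sum_le_sum fun k _ => hentry k).trans ?_
  rw [Finset.sum_add_distrib, Finset.sum_ite_eq, if_pos (Finset.mem_univ j)]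
  gcongr
  rw [Finset.sum_coe_sort Λ
    (fun k => if dist1 (j : Fin d → ℤ) k = 1 then (1 : ℝ) else 0), Finset.sum_boole]
  exact_mod_cast card_filter_dist1_eq_one_le Λ (j : Fin d → ℤ)

/-- Lemma 4.2(ii). There is `K > 0` depending only on `d` and `E` such
that for every cube `Λ` containing two fixed nearest-neighbour sites `i₁, i₂`, every
`λ > 0` and every `0 < δ ≤ 1/2`, the matrix `C_{++} = λ(1-δ²𝟙_{12}) - i(E+Δ)` is
invertible and `|Tr C_{++}⁻¹| ≥ |Λ|λ/(K(λ+1)²)`. -/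
theorem trace_Cpp_lower_bound (d : ℕ) (hd : 1 ≤ d) (E : ℝ) :
    ∃ K : ℝ, 0 < K ∧
      ∀ (i₁ i₂ : Fin d → ℤ), dist1 i₁ i₂ = 1 →
      ∀ (L : ℕ), i₁ ∈ cube d L → i₂ ∈ cube d L →
      ∀ (lam : ℝ), 0 < lam →
      ∀ (δ : ℝ), 0 < δ → δ ≤ 1 / 2 →
      IsUnit (Cpp (cube d L) i₁ i₂ E lam δ).det ∧
      ((cube d L).card : ℝ) * lam / (K * (lam + 1) ^ 2) ≤
        ‖Matrix.trace ((Cpp (cube d L) i₁ i₂ E lam δ)⁻¹)‖ := by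
  set M : ℝ := 1 + |E| + 2 * 3 ^ d with hM
  have hM0 : 0 < M := by positivity
  refine ⟨4 / 3 * M ^ 2, by positivity, ?_⟩
  intro i₁ i₂ _ L _ _ lam hlam δ hδ0 hδ
  have hδ2 : δ ^ 2 ≤ 1 / 4 := by nlinarith
  have hw : ∀ j : cube d L, 3 / 4 * lam ≤ lam * (1 - δ ^ 2 *
      (if (j : Fin d → ℤ) = i₁ ∨ (j : Fin d → ℤ) = i₂ then 1 else 0)) := by
    intro j
    split_ifs <;> nlinarith
  have hc : 0 < 3 / 4 * lam := by positivity
  have hA := Cpp_add_conjTranspose (cube d L) i₁ i₂ E lam δ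
  refine ⟨isUnit_det_of_add_conjTranspose_eq_diagonal _ _ (fun j => hc.trans_le (hw j)) hA, ?_⟩
  have hR : 0 < M ^ 2 * (lam + 1) ^ 2 := by positivity
  have hrow : ∀ j, ∑ k, ‖Cpp (cube d L) i₁ i₂ E lam δ j k‖ ^ 2 ≤ M ^ 2 * (lam + 1) ^ 2 := by
    intro j
    refine (sum_norm_sq_Cpp_le (cube d L) i₁ i₂ E lam δ hlam (by linarith) j).trans ?_
    have hB : (1 : ℝ) ≤ 3 ^ d := one_le_pow₀ (by norm_num)
    have hE := abs_nonneg E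
    generalize (3 : ℝ) ^ d = B at *
    calc (lam + |E| + B) ^ 2 + B ≤ (lam + |E| + 2 * B) ^ 2 := by
          nlinarith [mul_nonneg (add_nonneg hlam.le hE) (zero_le_one.trans hB)]
      _ ≤ (M * (lam + 1)) ^ 2 := by
          refine pow_le_pow_left₀ (by positivity) ?_ 2
          rw [hM]
          nlinarith [mul_nonneg hE hlam.le, mul_nonneg (zero_le_one.trans hB) hlam.le]
      _ = _ := by ring
  refine le_of_eq_of_le ?_ (mul_card_div_le_norm_trace_inv _ _ _ _ hc hR hw hA hrow)
  rw [Fintype.card_coe]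
  field_simp
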